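/- arXiv:2206.05996 — 2 statements merged into one kernel-verified Lean document; each statement's English description precedes it below -/
import Mathlib

section
/- Let X be a Banach space, μ : ℝ → ℝ a continuous, strictly increasing function with μ(s) → −∞ as s → −∞ and μ(s) → +∞ as s → +∞ (a homeomorphism of ℝ with inverse μ⁻¹), and U an evolution family on X satisfying ‖U(s,τ)‖ ≤ K e^{α(μ(s)−μ(τ))} for all s ≥ τ (α > 0, K ≥ 1). Suppose U admits a μ-exponential dichotomy with projections P(t) (with constants ν > 0, N ≥ 1) such that t ↦ P(t)x is continuous for each x ∈ X. Then the operator 𝒫 on C₀(ℝ,X) defined by (𝒫u)(s) = P(s)u(s) is a well-defined bounded linear projection, and the generalized evolution semigroup {T_t} is hyperbolic with structural projection 𝒫: 𝒫T_t = T_t𝒫 for all t ≥ 0, the restriction of T_t to the range of 𝒬 = Id − 𝒫 is a bijection onto itself, and ‖T_t 𝒫u‖_∞ ≤ N e^{−νt}‖u‖_∞ and ‖(T_t^𝒬)⁻¹ 𝒬u‖_∞ ≤ N e^{−νt}‖u‖_∞ for all t ≥ 0 and u ∈ C₀(ℝ,X). -/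
open Set Filter Topology
open scoped ZeroAtInfty

/-- A uniformly bounded, strongly continuous family of operators acts on continuous functions. -/
theorem continuous_apply_of_bounded {X : Type*} [NormedAddCommGroup X] [NormedSpace ℝ X]
    {P : ℝ → X →L[ℝ] X} {N : ℝ} (hP : ∀ t, ‖P t‖ ≤ N)
    (hPc : ∀ x : X, Continuous fun t => P t x) {u : ℝ → X} (hu : Continuous u) :
    Continuous fun s => P s (u s) := by
  rw [continuous_iff_continuousAt]
  intro r
  have h1 : Tendsto (fun s => N * ‖u s - u r‖) (𝓝 r) (𝓝 0) := by
    have : Continuous fun s => N * ‖u s - u r‖ := by fun_prop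
    simpa using this.tendsto r
  have h2 : Tendsto (fun s => P s (u s - u r)) (𝓝 r) (𝓝 0) :=
    squeeze_zero_norm (fun s => (P s).le_of_opNorm_le (hP s) _) h1
  simpa [ContinuousAt] using h2.add ((hPc (u r)).tendsto r)

/-- The multiplication operator on `C₀(ℝ, X)` induced by a uniformly bounded, strongly continuous
family of operators. -/
theorem exists_pointwise_operator {X : Type*} [NormedAddCommGroup X] [NormedSpace ℝ X]
    {P : ℝ → X →L[ℝ] X} {N : ℝ} (hP : ∀ t, ‖P t‖ ≤ N)
    (hPc : ∀ x : X, Continuous fun t => P t x) :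
    ∃ PP : C₀(ℝ, X) →L[ℝ] C₀(ℝ, X), ∀ u s, PP u s = P s (u s) := by
  have hN : 0 ≤ N := (norm_nonneg _).trans (hP 0)
  let L : C₀(ℝ, X) →ₗ[ℝ] C₀(ℝ, X) :=
    { toFun := fun u =>
        { toFun := fun s => P s (u s)
          continuous_toFun := continuous_apply_of_bounded hP hPc (map_continuous u)
          zero_at_infty' := squeeze_zero_norm (fun s => (P s).le_of_opNorm_le (hP s) _)
            (by simpa using (zero_at_infty u).norm.const_mul N) }
      map_add' := fun u v => by ext s; simp
      map_smul' := fun c u => by ext s; simp }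
  refine ⟨L.mkContinuous N fun u => ?_, fun u s => rfl⟩
  rw [← ZeroAtInftyContinuousMap.norm_toBCF_eq_norm]
  refine (BoundedContinuousFunction.norm_le (by positivity)).2 fun s => ?_
  exact (P s).le_of_opNorm_le_of_le (hP s) (u.toBCF.norm_coe_le_norm s)

theorem ZeroAtInftyContinuousMap.norm_apply_le {X : Type*} [NormedAddCommGroup X]
    (u : C₀(ℝ, X)) (s : ℝ) : ‖u s‖ ≤ ‖u‖ :=
  u.toBCF.norm_coe_le_norm s

theorem ZeroAtInftyContinuousMap.norm_le_of_forall {X : Type*} [NormedAddCommGroup X]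
    {u : C₀(ℝ, X)} {C : ℝ} (hC : 0 ≤ C) (h : ∀ s, ‖u s‖ ≤ C) : ‖u‖ ≤ C :=
  (BoundedContinuousFunction.norm_le (f := u.toBCF) hC).2 h

/-- Along a homeomorphism `σ` of `ℝ` with `r ≤ σ r`, a `C₀` section `v` of the ranges of `Q`
lifts to a `C₀` section `w` with `U (σ r) r (w r) = v (σ r)`, provided that the inverses of `U` on
the ranges of `Q` are uniformly bounded. -/
theorem exists_zeroAtInfty_lift {X : Type*} [NormedAddCommGroup X] [NormedSpace ℝ X]
    {U : ℝ → ℝ → X →L[ℝ] X} {Q : ℝ → X →L[ℝ] X} {C : ℝ} (σ : ℝ ≃ₜ ℝ) (hσ : ∀ r, r ≤ σ r)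
    (hU : ∀ x : X, ContinuousOn (fun p : ℝ × ℝ => U p.1 p.2 x) {p : ℝ × ℝ | p.2 ≤ p.1})
    (hQc : ∀ x : X, Continuous fun t => Q t x)
    (hQQ : ∀ t x, Q t (Q t x) = Q t x)
    (hcomm : ∀ r x, Q (σ r) (U (σ r) r x) = U (σ r) r (Q r x))
    (hsurj : ∀ r x, ∃ y, U (σ r) r (Q r y) = Q (σ r) x)
    (hinv : ∀ r x y, U (σ r) r (Q r y) = Q (σ r) x → ‖Q r y‖ ≤ C * ‖x‖)
    (v : C₀(ℝ, X)) (hv : ∀ s, Q s (v s) = v s) :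
    ∃ w : C₀(ℝ, X), (∀ r, Q r (w r) = w r) ∧ ∀ r, U (σ r) r (w r) = v (σ r) := by
  choose y hy using fun r => hsurj r (v (σ r))
  have hw : ∀ r, U (σ r) r (Q r (y r)) = v (σ r) := fun r => by rw [hy, hv]
  have hcont : Continuous fun r => Q r (y r) := by
    rw [continuous_iff_continuousAt]
    intro r₀
    set w₀ := Q r₀ (y r₀) with hw₀
    have hUc : Continuous fun r => U (σ r) r w₀ :=
      (hU w₀).comp_continuous (σ.continuous.prodMk continuous_id) hσ
    have hlim : Tendsto (fun r => C * ‖U (σ r) r w₀ - v (σ r)‖) (𝓝 r₀) (𝓝 0) := by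
      have : Continuous fun r => C * ‖U (σ r) r w₀ - v (σ r)‖ :=
        (hUc.sub ((map_continuous v).comp σ.continuous)).norm.const_mul C
      simpa [hw₀, hw] using this.tendsto r₀
    have hdiff : Tendsto (fun r => Q r (w₀ - y r)) (𝓝 r₀) (𝓝 0) := by
      refine squeeze_zero_norm (fun r => hinv r _ _ ?_) hlim
      rw [map_sub, map_sub, map_sub, hcomm, hw, hv]
    have := ((hQc w₀).tendsto r₀).sub hdiff
    simpa [ContinuousAt, hw₀, hQQ] using this
  refine ⟨⟨⟨fun r => Q r (y r), hcont⟩, ?_⟩, fun r => hQQ r _, hw⟩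
  refine squeeze_zero_norm (fun r => hinv r _ _ (hy r)) ?_
  simpa using (((zero_at_infty v).comp σ.isClosedEmbedding.tendsto_cocompact).norm.const_mul C)

/-- Suppose the evolution family `U` admits a `μ`-exponential dichotomy
with strongly continuous projections `P t` (constants `ν > 0`, `N ≥ 1`). Then
`(PP u) s = P s (u s)` defines a bounded linear projection `PP` on `C₀(ℝ, X)` and the
generalized evolution semigroup `{T_t}` is hyperbolic with structural projection `PP`. -/
theorem dichotomy_implies_hyperbolic
    (X : Type*) [NormedAddCommGroup X] [NormedSpace ℝ X] [CompleteSpace X]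
    (μ μinv : ℝ → ℝ)
    (hμc : Continuous μ) (hμm : StrictMono μ)
    (hμbot : Tendsto μ atBot atBot) (hμtop : Tendsto μ atTop atTop)
    (hinv₁ : ∀ s : ℝ, μinv (μ s) = s) (hinv₂ : ∀ s : ℝ, μ (μinv s) = s)
    (U : ℝ → ℝ → (X →L[ℝ] X))
    (hU1 : ∀ t : ℝ, U t t = ContinuousLinearMap.id ℝ X)
    (hU2 : ∀ t τ s : ℝ, s ≤ τ → τ ≤ t → (U t τ).comp (U τ s) = U t s)
    (hU3 : ∀ x : X, ContinuousOn (fun p : ℝ × ℝ => U p.1 p.2 x) {p : ℝ × ℝ | p.2 ≤ p.1})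
    (K α : ℝ) (hα : 0 < α) (hK : 1 ≤ K)
    (hbound : ∀ s τ : ℝ, τ ≤ s → ‖U s τ‖ ≤ K * Real.exp (α * (μ s - μ τ)))
    -- the generalized evolution semigroup
    (T : ℝ → (C₀(ℝ, X) →L[ℝ] C₀(ℝ, X)))
    (hT : ∀ t : ℝ, 0 ≤ t → ∀ w : C₀(ℝ, X), ∀ s : ℝ,
      T t w s = U s (μinv (μ s - t)) (w (μinv (μ s - t))))
    -- the `μ`-exponential dichotomy, with `Q t = Id − P t`
    (P Q : ℝ → (X →L[ℝ] X))
    (hQ : ∀ t : ℝ, Q t = ContinuousLinearMap.id ℝ X - P t)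
    (hPproj : ∀ t : ℝ, (P t).comp (P t) = P t)
    (hPcont : ∀ x : X, Continuous (fun t : ℝ => P t x))
    (hPcompat : ∀ s t : ℝ, s ≤ t → (P t).comp (U t s) = (U t s).comp (P s))
    (hUQbij : ∀ s t : ℝ, s ≤ t → Set.BijOn (U t s) (Set.range (Q s)) (Set.range (Q t)))
    (ν N : ℝ) (hν : 0 < ν) (hN : 1 ≤ N)
    (hdich₁ : ∀ s t : ℝ, s ≤ t →
      ‖(U t s).comp (P s)‖ ≤ N * Real.exp (-ν * (μ t - μ s)))
    (hdich₂ : ∀ s t : ℝ, s ≤ t → ∀ x y : X, y ∈ Set.range (Q s) → U t s y = Q t x →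
      ‖y‖ ≤ N * Real.exp (-ν * (μ t - μ s)) * ‖x‖) :
    ∃ PP : C₀(ℝ, X) →L[ℝ] C₀(ℝ, X),
      (∀ u : C₀(ℝ, X), ∀ s : ℝ, PP u s = P s (u s)) ∧
      PP.comp PP = PP ∧
      (∀ t : ℝ, 0 ≤ t → (T t).comp PP = PP.comp (T t)) ∧
      ∃ QQ : C₀(ℝ, X) →L[ℝ] C₀(ℝ, X),
        QQ = ContinuousLinearMap.id ℝ (C₀(ℝ, X)) - PP ∧
        (∀ t : ℝ, 0 ≤ t → Set.BijOn (T t) (Set.range QQ) (Set.range QQ)) ∧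
        (∀ t : ℝ, 0 ≤ t → ∀ u : C₀(ℝ, X),
          ‖T t (PP u)‖ ≤ N * Real.exp (-ν * t) * ‖u‖) ∧
        (∀ t : ℝ, 0 ≤ t → ∀ u v : C₀(ℝ, X), v ∈ Set.range QQ → T t v = QQ u →
          ‖v‖ ≤ N * Real.exp (-ν * t) * ‖u‖) := by
  have hPP : ∀ t x, P t (P t x) = P t x := fun t x => DFunLike.congr_fun (hPproj t) x
  have hQx : ∀ t x, Q t x = x - P t x := fun t x => by simp [hQ]
  have hQQ : ∀ t x, Q t (Q t x) = Q t x := fun t x => by simp [hQx, hPP]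
  have hPU : ∀ s t, s ≤ t → ∀ x, P t (U t s x) = U t s (P s x) :=
    fun s t h x => DFunLike.congr_fun (hPcompat s t h) x
  have hQU : ∀ s t, s ≤ t → ∀ x, Q t (U t s x) = U t s (Q s x) :=
    fun s t h x => by simp [hQx, hPU s t h]
  have hPN : ∀ t, ‖P t‖ ≤ N := fun t => by simpa [hU1] using hdich₁ t t le_rfl
  have hQc : ∀ x, Continuous fun t => Q t x := fun x => by
    simp only [hQx]
    exact continuous_const.sub (hPcont x)
  obtain ⟨PP, hPPa⟩ := exists_pointwise_operator hPN hPcont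
  let e : ℝ ≃o ℝ := hμm.orderIsoOfRightInverse μ μinv hinv₂
  let σ : ℝ → ℝ ≃ₜ ℝ := fun t =>
    (e.toHomeomorph.trans (Homeomorph.addRight t)).trans e.toHomeomorph.symm
  have hσa : ∀ t r, σ t r = μinv (μ r + t) := fun _ _ => rfl
  have hμσ : ∀ t r, μ (σ t r) = μ r + t := fun t r => by rw [hσa, hinv₂]
  have hσ : ∀ t, 0 ≤ t → ∀ r, r ≤ σ t r := fun t ht r => by
    rw [← hμm.le_iff_le, hμσ]; linarith
  have hρσ : ∀ t r, μinv (μ (σ t r) - t) = r := fun t r => by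
    rw [hμσ, add_sub_cancel_right, hinv₁]
  have hTσ : ∀ t, 0 ≤ t → ∀ w r, T t w (σ t r) = U (σ t r) r (w r) := fun t ht w r => by
    rw [hT t ht, hρσ]
  have hext : ∀ t, ∀ u v : C₀(ℝ, X), (∀ r, u (σ t r) = v (σ t r)) → u = v := fun t u v h => by
    ext s
    obtain ⟨r, rfl⟩ := (σ t).surjective s
    exact h r
  have hcommT : ∀ t, 0 ≤ t → (T t).comp PP = PP.comp (T t) := fun t ht => by
    ext1 u
    refine hext t _ _ fun r => ?_
    simp [hTσ t ht, hPPa, hPU _ _ (hσ t ht r)]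
  have hrange : ∀ v, v ∈ Set.range (ContinuousLinearMap.id ℝ C₀(ℝ, X) - PP) ↔
      ∀ s, Q s (v s) = v s := by
    refine fun v => ⟨?_, fun h => ⟨v, ?_⟩⟩
    · rintro ⟨u, rfl⟩ s
      simp [hPPa, hQx, hPP]
    · ext s
      simpa [hPPa, hQx] using h s
  have hinv : ∀ t, 0 ≤ t → ∀ r x y, U (σ t r) r (Q r y) = Q (σ t r) x →
      ‖Q r y‖ ≤ N * Real.exp (-ν * t) * ‖x‖ := fun t ht r x y h => by
    simpa [hμσ] using hdich₂ r (σ t r) (hσ t ht r) x (Q r y) ⟨y, rfl⟩ h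
  refine ⟨PP, hPPa, ?_, hcommT, _, rfl, fun t ht => ⟨?_, ?_, ?_⟩, fun t ht u => ?_,
    fun t ht u v hv h => ?_⟩
  · ext u s
    simp [hPPa, hPP]
  · intro v hv
    rw [hrange] at hv ⊢
    intro s
    rw [hT t ht]
    obtain ⟨r, rfl⟩ := (σ t).surjective s
    rw [hρσ, hQU _ _ (hσ t ht r), hv]
  · intro v hv w hw h
    rw [hrange] at hv hw
    ext r
    refine (hUQbij r (σ t r) (hσ t ht r)).injOn ⟨_, hv r⟩ ⟨_, hw r⟩ ?_
    rw [← hTσ t ht, ← hTσ t ht, h]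
  · intro v hv
    rw [hrange] at hv
    obtain ⟨w, hwQ, hw⟩ := exists_zeroAtInfty_lift (σ t) (hσ t ht) hU3 hQc hQQ
      (fun r => hQU _ _ (hσ t ht r))
      (fun r x => by
        obtain ⟨_, ⟨y, rfl⟩, h⟩ := (hUQbij r (σ t r) (hσ t ht r)).surjOn ⟨x, rfl⟩
        exact ⟨y, h⟩)
      (hinv t ht) v hv
    exact ⟨w, (hrange w).2 hwQ, hext t _ _ fun r => by rw [hTσ t ht, hw]⟩
  · refine ZeroAtInftyContinuousMap.norm_le_of_forall (by positivity) fun s => ?_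
    obtain ⟨r, rfl⟩ := (σ t).surjective s
    rw [hTσ t ht, hPPa]
    have h := hdich₁ r (σ t r) (hσ t ht r)
    rw [hμσ, add_sub_cancel_left] at h
    exact ((U (σ t r) r).comp (P r)).le_of_opNorm_le_of_le h (u.norm_apply_le r)
  · rw [hrange] at hv
    refine ZeroAtInftyContinuousMap.norm_le_of_forall (by positivity) fun r => ?_
    have h' : U (σ t r) r (Q r (v r)) = Q (σ t r) (u (σ t r)) := by
      rw [hv, ← hTσ t ht, h]
      simp [hPPa, hQx]
    rw [← hv]
    exact (hinv t ht r _ _ h').trans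
      (mul_le_mul_of_nonneg_left (u.norm_apply_le _) (by positivity))
end

section
/- Let X be a Banach space, μ : ℝ → ℝ a continuous, strictly increasing function with μ(s) → −∞ as s → −∞ and μ(s) → +∞ as s → +∞ (a homeomorphism of ℝ with inverse μ⁻¹), and U an evolution family on X satisfying ‖U(s,τ)‖ ≤ K e^{α(μ(s)−μ(τ))} for all s ≥ τ (α > 0, K ≥ 1). If the generalized evolution semigroup {T_t} on C₀(ℝ,X) is hyperbolic with some structural projection 𝒫, then the evolution family U admits a μ-exponential dichotomy: there exist projections P(t) : X → X, t ∈ ℝ, compatible with U, and constants ν > 0, N ≥ 1 such that ‖U(t,s)P(s)‖ ≤ N e^{−ν(μ(t)−μ(s))} and ‖U_Q(s,t)Q(t)‖ ≤ N e^{−ν(μ(t)−μ(s))} for all t ≥ s. -/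
open Set Filter Topology
open scoped ZeroAtInfty

namespace ZeroAtInftyContinuousMap

section Multiplier

variable {Y X : Type*} [TopologicalSpace Y] [NormedAddCommGroup X]

lemma norm_apply_le_norm (u : C₀(Y, X)) (r : Y) : ‖u r‖ ≤ ‖u‖ :=
  u.toBCF.norm_coe_le_norm r

lemma norm_le_of_forall_le {u : C₀(Y, X)} {C : ℝ} (hC : 0 ≤ C) (h : ∀ r, ‖u r‖ ≤ C) :
    ‖u‖ ≤ C :=
  (BoundedContinuousFunction.norm_le (f := u.toBCF) hC).2 h

variable [NormedSpace ℝ X]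

/-- Pointwise product of a continuous `[0, 1]`-valued function and an element of `C₀(Y, X)`. -/
def multiplier (φ : C(Y, unitInterval)) (u : C₀(Y, X)) : C₀(Y, X) where
  toFun r := (φ r : ℝ) • u r
  continuous_toFun := by fun_prop
  zero_at_infty' := by
    refine squeeze_zero_norm (fun r => ?_) (tendsto_zero_iff_norm_tendsto_zero.1 u.zero_at_infty')
    rw [norm_smul, Real.norm_of_nonneg (φ r).2.1]
    exact mul_le_of_le_one_left (norm_nonneg _) (φ r).2.2

lemma multiplier_apply (φ : C(Y, unitInterval)) (u : C₀(Y, X)) (r : Y) :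
    multiplier φ u r = (φ r : ℝ) • u r := rfl

lemma multiplier_add (φ : C(Y, unitInterval)) (u v : C₀(Y, X)) :
    multiplier φ (u + v) = multiplier φ u + multiplier φ v := by
  ext r
  simp [multiplier_apply]

lemma norm_multiplier_le (φ : C(Y, unitInterval)) (u : C₀(Y, X)) :
    ‖multiplier φ u‖ ≤ ‖u‖ := by
  refine norm_le_of_forall_le (norm_nonneg _) fun r => ?_
  rw [multiplier_apply, norm_smul, Real.norm_of_nonneg (φ r).2.1]
  exact (mul_le_of_le_one_left (norm_nonneg _) (φ r).2.2).trans (norm_apply_le_norm u r)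

/-- A multiplier equal to `1` at `s` that cuts `u` down to any norm exceeding `‖u s‖`. -/
lemma exists_norm_multiplier_le (u : C₀(Y, X)) (s : Y) {c : ℝ} (hc : 0 < c) (hs : ‖u s‖ ≤ c) :
    ∃ φ : C(Y, unitInterval), (φ s : ℝ) = 1 ∧ ‖multiplier φ u‖ ≤ c := by
  have hpos : ∀ r, 0 < max c ‖u r‖ := fun r => lt_max_of_lt_left hc
  let φ : C(Y, unitInterval) :=
    { toFun := fun r => ⟨c / max c ‖u r‖, by have := hpos r; positivity,
        (div_le_one (hpos r)).2 (le_max_left _ _)⟩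
      continuous_toFun := by
        refine Continuous.subtype_mk ?_ _
        exact continuous_const.div (by fun_prop) fun r => (hpos r).ne' }
  have hφ : ∀ r, (φ r : ℝ) = c / max c ‖u r‖ := fun r => rfl
  refine ⟨φ, by rw [hφ, max_eq_left hs, div_self hc.ne'], ?_⟩
  refine norm_le_of_forall_le hc.le fun r => ?_
  rw [multiplier_apply, norm_smul, Real.norm_of_nonneg (φ r).2.1, hφ, div_mul_eq_mul_div,
    div_le_iff₀ (hpos r)]
  exact mul_le_mul_of_nonneg_left (le_max_right _ _) hc.le

/-- An operator on `C₀(Y, X)` commuting with multipliers acts pointwise. -/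
lemma apply_eq_zero_of_commute {A : C₀(Y, X) →L[ℝ] C₀(Y, X)}
    (hA : ∀ φ u, A (multiplier φ u) = multiplier φ (A u)) {u : C₀(Y, X)} {s : Y} (hu : u s = 0) :
    A u s = 0 := by
  rw [← norm_le_zero_iff]
  refine le_of_forall_pos_le_add fun ε hε => ?_
  have hc : 0 < ε / (‖A‖ + 1) := by positivity
  obtain ⟨φ, hφ, hle⟩ := exists_norm_multiplier_le u s hc (by rw [hu, norm_zero]; exact hc.le)
  have h1 : A u s = A (multiplier φ u) s := by rw [hA, multiplier_apply, hφ, one_smul]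
  rw [h1, zero_add]
  calc ‖A (multiplier φ u) s‖ ≤ ‖A (multiplier φ u)‖ := norm_apply_le_norm _ _
    _ ≤ ‖A‖ * (ε / (‖A‖ + 1)) := A.le_opNorm_of_le hle
    _ ≤ (‖A‖ + 1) * (ε / (‖A‖ + 1)) := by gcongr; linarith
    _ = ε := by field_simp

lemma apply_congr_of_commute {A : C₀(Y, X) →L[ℝ] C₀(Y, X)}
    (hA : ∀ φ u, A (multiplier φ u) = multiplier φ (A u)) {u v : C₀(Y, X)} {s : Y}
    (huv : u s = v s) : A u s = A v s := by
  have h := apply_eq_zero_of_commute hA (u := u - v) (s := s) (by simp [huv])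
  rwa [map_sub, sub_apply, sub_eq_zero] at h

/-- Evaluation at a point, as a continuous linear map. -/
noncomputable def evalCLM (s : Y) : C₀(Y, X) →L[ℝ] X :=
  LinearMap.mkContinuous
    { toFun := fun u => u s
      map_add' := fun _ _ => rfl
      map_smul' := fun _ _ => rfl } 1 fun u => by simpa using norm_apply_le_norm u s

lemma evalCLM_apply (s : Y) (u : C₀(Y, X)) : evalCLM s u = u s := rfl

end Multiplier

section Peak

variable {X : Type*} [NormedAddCommGroup X] [NormedSpace ℝ X]

/-- The function `r ↦ (1 + |r - s|)⁻¹ x`, whose norm is attained at `s`. -/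
noncomputable def peakFun (s : ℝ) (x : X) : C₀(ℝ, X) where
  toFun r := (1 + dist r s)⁻¹ • x
  continuous_toFun := by
    refine Continuous.smul (Continuous.inv₀ (by fun_prop) fun r => ?_) continuous_const
    have := dist_nonneg (x := r) (y := s)
    positivity
  zero_at_infty' := by
    have h : Tendsto (fun r : ℝ => (1 + dist r s)⁻¹) (cocompact ℝ) (𝓝 0) :=
      tendsto_inv_atTop_zero.comp
        (tendsto_atTop_add_const_left _ _ (tendsto_dist_right_cocompact_atTop s))
    simpa using h.smul_const x

lemma peakFun_apply (s : ℝ) (x : X) (r : ℝ) : peakFun s x r = (1 + dist r s)⁻¹ • x := rfl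

lemma norm_peakFun_le (s : ℝ) (x : X) : ‖peakFun s x‖ ≤ ‖x‖ := by
  refine norm_le_of_forall_le (norm_nonneg _) fun r => ?_
  have h := dist_nonneg (x := r) (y := s)
  rw [peakFun_apply, norm_smul, Real.norm_of_nonneg (by positivity)]
  exact mul_le_of_le_one_left (norm_nonneg _) (inv_le_one_of_one_le₀ (by linarith))

/-- `peakFun s` as a continuous linear map. -/
noncomputable def peak (s : ℝ) : X →L[ℝ] C₀(ℝ, X) :=
  LinearMap.mkContinuous
    { toFun := peakFun s
      map_add' := fun x y => by ext r; exact smul_add _ _ _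
      map_smul' := fun c x => by ext r; exact smul_comm _ _ _ } 1 fun x => by
    simpa using norm_peakFun_le s x

lemma peak_apply (s : ℝ) (x : X) : peak s x = peakFun s x := rfl

lemma peak_apply_self (s : ℝ) (x : X) : peak s x s = x := by
  simp [peak_apply, peakFun_apply]

lemma norm_peak_le (s : ℝ) (x : X) : ‖peak s x‖ ≤ ‖x‖ :=
  norm_peakFun_le s x

end Peak

end ZeroAtInftyContinuousMap

section Hyperbolic

variable {E : Type*} [NormedAddCommGroup E]

lemma eq_zero_of_norm_le_mul_exp_neg {x : E} {C ν : ℝ} (hν : 0 < ν)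
    (h : ∀ t : ℝ, 0 ≤ t → ‖x‖ ≤ C * Real.exp (-ν * t)) : x = 0 := by
  have hlim : Tendsto (fun t : ℝ => C * Real.exp (-ν * t)) atTop (𝓝 (C * 0)) :=
    (Real.tendsto_exp_atBot.comp
      (tendsto_id.const_mul_atTop_of_neg (neg_lt_zero.2 hν))).const_mul C
  rw [mul_zero] at hlim
  exact norm_le_zero_iff.1 (ge_of_tendsto hlim ((eventually_ge_atTop 0).mono h))

variable [NormedSpace ℝ E]

/-- A vector with a bounded forward orbit lies in the stable subspace. -/
lemma unstable_part_eq_zero {T : ℝ → E →L[ℝ] E} {Q : E →L[ℝ] E} {ν N : ℝ} (hν : 0 < ν) (hN : 0 ≤ N)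
    (hcomm : ∀ t, 0 ≤ t → ∀ u, T t (Q u) = Q (T t u))
    (hunstable : ∀ t : ℝ, 0 ≤ t → ∀ u v : E, v ∈ Set.range Q → T t v = Q u →
      ‖v‖ ≤ N * Real.exp (-ν * t) * ‖u‖)
    {w : E} {C : ℝ} (hw : ∀ t, 0 ≤ t → ‖T t w‖ ≤ C) : Q w = 0 := by
  refine eq_zero_of_norm_le_mul_exp_neg (C := N * C) hν fun t ht => ?_
  calc ‖Q w‖ ≤ N * Real.exp (-ν * t) * ‖T t w‖ :=
        hunstable t ht _ _ (Set.mem_range_self w) (hcomm t ht w)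
    _ ≤ N * Real.exp (-ν * t) * C := by gcongr; exact hw t ht
    _ = N * C * Real.exp (-ν * t) := by ring

/-- A vector with a bounded backward orbit lies in the unstable subspace. -/
lemma stable_part_eq_zero {T : ℝ → E →L[ℝ] E} {P : E →L[ℝ] E} {ν N : ℝ} (hν : 0 < ν) (hN : 0 ≤ N)
    (hcomm : ∀ t, 0 ≤ t → ∀ u, T t (P u) = P (T t u))
    (hstable : ∀ t : ℝ, 0 ≤ t → ∀ u : E, ‖T t (P u)‖ ≤ N * Real.exp (-ν * t) * ‖u‖)
    {w : E} {C : ℝ} (hw : ∀ t, 0 ≤ t → ∃ v, T t v = w ∧ ‖v‖ ≤ C) : P w = 0 := by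
  refine eq_zero_of_norm_le_mul_exp_neg (C := N * C) hν fun t ht => ?_
  obtain ⟨v, hv, hvC⟩ := hw t ht
  calc ‖P w‖ = ‖T t (P v)‖ := by rw [hcomm t ht, hv]
    _ ≤ N * Real.exp (-ν * t) * ‖v‖ := hstable t ht v
    _ ≤ N * Real.exp (-ν * t) * C := by gcongr
    _ = N * C * Real.exp (-ν * t) := by ring

end Hyperbolic

open ZeroAtInftyContinuousMap

/-- If the generalized evolution semigroup `{T_t}` on `C₀(ℝ, X)` is
hyperbolic with some structural projection `PP`, then the evolution family `U` admits a
`μ`-exponential dichotomy: there exist projections `P t` compatible with `U` and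
constants `ν > 0`, `N ≥ 1` with `‖U(t,s) P(s)‖ ≤ N e^{−ν(μ t − μ s)}` and
`‖U_Q(s,t) Q(t)‖ ≤ N e^{−ν(μ t − μ s)}` for all `t ≥ s`. -/
theorem hyperbolic_implies_dichotomy
    (X : Type*) [NormedAddCommGroup X] [NormedSpace ℝ X] [CompleteSpace X]
    (μ μinv : ℝ → ℝ)
    (hμc : Continuous μ) (hμm : StrictMono μ)
    (hμbot : Tendsto μ atBot atBot) (hμtop : Tendsto μ atTop atTop)
    (hinv₁ : ∀ s : ℝ, μinv (μ s) = s) (hinv₂ : ∀ s : ℝ, μ (μinv s) = s)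
    (U : ℝ → ℝ → (X →L[ℝ] X))
    (hU1 : ∀ t : ℝ, U t t = ContinuousLinearMap.id ℝ X)
    (hU2 : ∀ t τ s : ℝ, s ≤ τ → τ ≤ t → (U t τ).comp (U τ s) = U t s)
    (hU3 : ∀ x : X, ContinuousOn (fun p : ℝ × ℝ => U p.1 p.2 x) {p : ℝ × ℝ | p.2 ≤ p.1})
    (K α : ℝ) (hα : 0 < α) (hK : 1 ≤ K)
    (hbound : ∀ s τ : ℝ, τ ≤ s → ‖U s τ‖ ≤ K * Real.exp (α * (μ s - μ τ)))
    -- the generalized evolution semigroup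
    (T : ℝ → (C₀(ℝ, X) →L[ℝ] C₀(ℝ, X)))
    (hT : ∀ t : ℝ, 0 ≤ t → ∀ w : C₀(ℝ, X), ∀ s : ℝ,
      T t w s = U s (μinv (μ s - t)) (w (μinv (μ s - t))))
    -- hyperbolicity with structural projection `PP` (and `QQ = Id − PP`)
    (PP QQ : C₀(ℝ, X) →L[ℝ] C₀(ℝ, X))
    (hQQ : QQ = ContinuousLinearMap.id ℝ (C₀(ℝ, X)) - PP)
    (hproj : PP.comp PP = PP)
    (hcomm : ∀ t : ℝ, 0 ≤ t → (T t).comp PP = PP.comp (T t))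
    (hbij : ∀ t : ℝ, 0 ≤ t → Set.BijOn (T t) (Set.range QQ) (Set.range QQ))
    (ν N : ℝ) (hν : 0 < ν) (hN : 1 ≤ N)
    (hstable : ∀ t : ℝ, 0 ≤ t → ∀ u : C₀(ℝ, X),
      ‖T t (PP u)‖ ≤ N * Real.exp (-ν * t) * ‖u‖)
    (hunstable : ∀ t : ℝ, 0 ≤ t → ∀ u v : C₀(ℝ, X), v ∈ Set.range QQ → T t v = QQ u →
      ‖v‖ ≤ N * Real.exp (-ν * t) * ‖u‖) :
    ∃ P Q : ℝ → (X →L[ℝ] X),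
      (∀ t : ℝ, Q t = ContinuousLinearMap.id ℝ X - P t) ∧
      (∀ t : ℝ, (P t).comp (P t) = P t) ∧
      (∀ s t : ℝ, s ≤ t → (P t).comp (U t s) = (U t s).comp (P s)) ∧
      (∀ s t : ℝ, s ≤ t → Set.BijOn (U t s) (Set.range (Q s)) (Set.range (Q t))) ∧
      ∃ ν' N' : ℝ, 0 < ν' ∧ 1 ≤ N' ∧
        (∀ s t : ℝ, s ≤ t →
          ‖(U t s).comp (P s)‖ ≤ N' * Real.exp (-ν' * (μ t - μ s))) ∧
        (∀ s t : ℝ, s ≤ t → ∀ x y : X, y ∈ Set.range (Q s) → U t s y = Q t x →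
          ‖y‖ ≤ N' * Real.exp (-ν' * (μ t - μ s)) * ‖x‖) := by
  have hN0 : (0 : ℝ) ≤ N := by linarith
  have hμinvc : Continuous μinv := by
    let e := hμm.orderIsoOfRightInverse μ μinv hinv₂
    exact e.symm.continuous
  -- `σ τ` moves a point by `-τ` in the time scale `μ`
  let σ : ℝ → C(ℝ, ℝ) := fun τ =>
    ⟨fun r => μinv (μ r - τ), hμinvc.comp (hμc.sub continuous_const)⟩
  have hσ : ∀ τ r, σ τ r = μinv (μ r - τ) := fun _ _ => rfl
  have hσneg : ∀ τ r, σ (-τ) (σ τ r) = r := fun τ r => by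
    rw [hσ, hσ, hinv₂, sub_neg_eq_add, sub_add_cancel, hinv₁]
  have hσsub : ∀ s t, σ (μ t - μ s) t = s := fun s t => by rw [hσ, sub_sub_cancel, hinv₁]
  have hTm : ∀ τ, 0 ≤ τ → ∀ φ u, T τ (multiplier φ u) = multiplier (φ.comp (σ τ)) (T τ u) := by
    intro τ hτ φ u
    ext r
    rw [multiplier_apply, hT τ hτ, hT τ hτ, multiplier_apply, map_smul]
    rfl
  have hTm' : ∀ τ, 0 ≤ τ → ∀ φ u, T τ (multiplier (φ.comp (σ (-τ))) u) = multiplier φ (T τ u) := by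
    intro τ hτ φ u
    rw [hTm τ hτ]
    congr 1
    ext r
    simp [hσneg]
  have hTU : ∀ s t, s ≤ t → ∀ w, T (μ t - μ s) w t = U t s (w s) := fun s t hst w => by
    have h := hT (μ t - μ s) (sub_nonneg.2 (hμm.monotone hst)) w t
    rwa [← hσ, hσsub] at h
  have hQ : ∀ u, QQ u = u - PP u := fun u => by rw [hQQ]; rfl
  have hPP : ∀ u, PP (PP u) = PP u := fun u => DFunLike.congr_fun hproj u
  have hcommP : ∀ t, 0 ≤ t → ∀ u, T t (PP u) = PP (T t u) := fun t ht u =>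
    DFunLike.congr_fun (hcomm t ht) u
  have hcommQ : ∀ t, 0 ≤ t → ∀ u, T t (QQ u) = QQ (T t u) := fun t ht u => by
    rw [hQ, hQ, map_sub, hcommP t ht]
  have hmulP : ∀ φ u, QQ (multiplier φ (PP u)) = 0 := by
    intro φ u
    refine unstable_part_eq_zero (C := N * ‖u‖) hν hN0 hcommQ hunstable fun t ht => ?_
    rw [hTm t ht]
    refine (norm_multiplier_le _ _).trans ((hstable t ht u).trans ?_)
    have : Real.exp (-ν * t) ≤ 1 := Real.exp_le_one_iff.2 (by nlinarith)
    gcongr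
    exact mul_le_of_le_one_right hN0 this
  have hmulQ : ∀ φ u, PP (multiplier φ (QQ u)) = 0 := by
    intro φ u
    refine stable_part_eq_zero (C := N * ‖u‖) hν hN0 hcommP hstable fun t ht => ?_
    obtain ⟨v, hv, hvu⟩ := (hbij t ht).surjOn (Set.mem_range_self u)
    refine ⟨multiplier (φ.comp (σ (-t))) v, by rw [hTm' t ht, hvu], ?_⟩
    refine (norm_multiplier_le _ _).trans ((hunstable t ht u v hv hvu).trans ?_)
    have : Real.exp (-ν * t) ≤ 1 := Real.exp_le_one_iff.2 (by nlinarith)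
    gcongr
    exact mul_le_of_le_one_right hN0 this
  have hPm : ∀ φ u, PP (multiplier φ u) = multiplier φ (PP u) := by
    intro φ u
    have h1 : multiplier φ u = multiplier φ (PP u) + multiplier φ (QQ u) := by
      rw [← multiplier_add, hQ, add_sub_cancel]
    have h2 := hmulP φ u
    rw [hQ, sub_eq_zero] at h2
    rw [h1, map_add, hmulQ, add_zero, ← h2]
  let P : ℝ → X →L[ℝ] X := fun s => (evalCLM s).comp (PP.comp (peak s))
  let Q : ℝ → X →L[ℝ] X := fun s => ContinuousLinearMap.id ℝ X - P s
  have hPapp : ∀ u s, PP u s = P s (u s) := fun u s =>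
    apply_congr_of_commute hPm (peak_apply_self s (u s)).symm
  have hQx : ∀ s x, Q s x = x - P s x := fun _ _ => rfl
  have hQapp : ∀ u s, QQ u s = Q s (u s) := fun u s => by
    rw [hQ, ZeroAtInftyContinuousMap.sub_apply, hPapp, hQx]
  have hPid : ∀ s x, P s (P s x) = P s x := fun s x => by
    have h := hPapp (PP (peak s x)) s
    rw [hPP, hPapp, peak_apply_self] at h
    exact h.symm
  have hQid : ∀ s x, Q s (Q s x) = Q s x := fun s x => by simp [hQx, hPid]
  have hPU : ∀ s t, s ≤ t → ∀ x, P t (U t s x) = U t s (P s x) := fun s t hst x => by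
    have h := hTU s t hst (PP (peak s x))
    rw [hcommP _ (sub_nonneg.2 (hμm.monotone hst)), hPapp, hPapp, hTU s t hst,
      peak_apply_self] at h
    exact h
  have hQU : ∀ s t, s ≤ t → ∀ x, Q t (U t s x) = U t s (Q s x) := fun s t hst x => by
    rw [hQx, hQx, map_sub, hPU s t hst]
  have hlower : ∀ s t, s ≤ t → ∀ y, Q s y = y →
      ‖y‖ ≤ N * Real.exp (-ν * (μ t - μ s)) * ‖U t s y‖ := by
    intro s t hst y hy
    have hτ := sub_nonneg.2 (hμm.monotone hst)
    set τ := μ t - μ s with hτdef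
    set u := QQ (peak s y) with hu
    have hus : u s = y := by rw [hu, hQapp, peak_apply_self, hy]
    have hgt : T τ u t = U t s y := by rw [hTU s t hst, hus]
    refine le_of_forall_pos_le_add fun ε hε => ?_
    have hA : 0 < N * Real.exp (-ν * τ) := by positivity
    have hδ : 0 < ε / (N * Real.exp (-ν * τ)) := by positivity
    obtain ⟨φ, hφ, hle⟩ := exists_norm_multiplier_le (T τ u) t
      (c := ‖U t s y‖ + ε / (N * Real.exp (-ν * τ))) (by positivity) (by rw [hgt]; linarith)
    set v := multiplier (φ.comp (σ (-τ))) u with hv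
    have hvQ : QQ v = v := by rw [hQ, hv, hu, hmulQ, sub_zero]
    have hTv : T τ v = multiplier φ (T τ u) := hTm' τ hτ φ u
    have hvs : v s = y := by
      have h1 : σ (-τ) s = t := by
        rw [hσ, hτdef, sub_neg_eq_add, add_sub_cancel, hinv₁]
      rw [hv, multiplier_apply, ContinuousMap.comp_apply, h1, hφ, one_smul, hus]
    calc ‖y‖ = ‖v s‖ := by rw [hvs]
      _ ≤ ‖v‖ := norm_apply_le_norm v s
      _ ≤ N * Real.exp (-ν * τ) * ‖T τ v‖ :=
        hunstable τ hτ _ _ ⟨v, hvQ⟩ (by rw [← hcommQ τ hτ, hvQ])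
      _ ≤ N * Real.exp (-ν * τ) * (‖U t s y‖ + ε / (N * Real.exp (-ν * τ))) := by
        rw [hTv]; gcongr
      _ = N * Real.exp (-ν * τ) * ‖U t s y‖ + ε := by
        rw [mul_add, mul_div_cancel₀ _ hA.ne']
  have hmem : ∀ s y, y ∈ Set.range (Q s) → Q s y = y := by
    rintro s _ ⟨z, rfl⟩
    exact hQid s z
  have hQnorm : ∀ t x, ‖Q t x‖ ≤ ‖QQ‖ * ‖x‖ := fun t x => by
    have h := hQapp (peak t x) t
    rw [peak_apply_self] at h
    rw [← h]
    exact (norm_apply_le_norm _ _).trans (QQ.le_opNorm_of_le (norm_peak_le t x))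
  refine ⟨P, Q, fun _ => rfl, fun t => ?_, fun s t hst => ?_, fun s t hst => ⟨?_, ?_, ?_⟩,
    ν, N * (‖QQ‖ + 1), hν, ?_, fun s t hst => ?_, fun s t hst x y hy hxy => ?_⟩
  · ext x
    exact hPid t x
  · ext x
    exact hPU s t hst x
  · rintro _ ⟨y, rfl⟩
    exact ⟨U t s y, hQU s t hst y⟩
  · intro y hy z hz hyz
    have h := hlower s t hst (y - z) (by rw [map_sub, hmem s y hy, hmem s z hz])
    rw [map_sub, sub_eq_zero.2 hyz, norm_zero, mul_zero] at h
    exact sub_eq_zero.1 (norm_le_zero_iff.1 h)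
  · intro z hz
    obtain ⟨v, ⟨w, hw⟩, hv⟩ := (hbij _ (sub_nonneg.2 (hμm.monotone hst))).surjOn
      (Set.mem_range_self (peak t z))
    refine ⟨v s, ⟨w s, by rw [← hQapp, hw]⟩, ?_⟩
    rw [← hTU s t hst, hv, hQapp, peak_apply_self, hmem t z hz]
  · nlinarith [norm_nonneg QQ]
  · refine ContinuousLinearMap.opNorm_le_bound _ (by positivity) fun x => ?_
    have h : T (μ t - μ s) (PP (peak s x)) t = U t s (P s x) := by
      rw [hTU s t hst, hPapp, peak_apply_self]
    change ‖U t s (P s x)‖ ≤ _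
    rw [← h]
    calc ‖T (μ t - μ s) (PP (peak s x)) t‖ ≤ ‖T (μ t - μ s) (PP (peak s x))‖ :=
          norm_apply_le_norm _ _
      _ ≤ N * Real.exp (-ν * (μ t - μ s)) * ‖peak s x‖ :=
        hstable _ (sub_nonneg.2 (hμm.monotone hst)) _
      _ ≤ N * (‖QQ‖ + 1) * Real.exp (-ν * (μ t - μ s)) * ‖x‖ := by
        gcongr
        · exact le_mul_of_one_le_right hN0 (by linarith [norm_nonneg QQ])
        · exact norm_peak_le s x
  · calc ‖y‖ ≤ N * Real.exp (-ν * (μ t - μ s)) * ‖U t s y‖ := hlower s t hst y (hmem s y hy)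
      _ ≤ N * Real.exp (-ν * (μ t - μ s)) * ((‖QQ‖ + 1) * ‖x‖) := by
        rw [hxy]
        gcongr
        refine (hQnorm t x).trans ?_
        gcongr
        linarith
      _ = N * (‖QQ‖ + 1) * Real.exp (-ν * (μ t - μ s)) * ‖x‖ := by ring
end
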